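/- Green's function of the clamped biharmonic problem: for every continuous function f : [0,1] → ℝ, the function u(x) = ∫_0^1 K(x,y)·f(y) dy satisfies u(0) = u′(0) = u(1) = u′(1) = 0, u is four times differentiable on (0,1), and u⁗(x) = f(x) for all x ∈ (0,1). -/

import Mathlib

open Set

/-- Green's kernel of the clamped biharmonic operator on `[0,1]`:
`K(x,y) = (1/6)(1-x)²y²[2x(1-y) + x - y]` for `y ≤ x` and
`K(x,y) = (1/6)x²(1-y)²[2y(1-x) + y - x]` for `x ≤ y`. -/
noncomputable def Kgreen (x y : ℝ) : ℝ :=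
  if y ≤ x then (1/6) * (1 - x)^2 * y^2 * (2*x*(1 - y) + x - y)
  else (1/6) * x^2 * (1 - y)^2 * (2*y*(1 - x) + y - x)

/-- If `v 0, …, v n` are successive derivatives on an open set where `u = v 0`, then they are the
iterated derivatives of `u` there. -/
theorem eqOn_iteratedDeriv_of_hasDerivAt {u : ℝ → ℝ} {v : ℕ → ℝ → ℝ} {s : Set ℝ} {n : ℕ}
    (hs : IsOpen s) (hu : EqOn u (v 0) s)
    (hv : ∀ i < n, ∀ x ∈ s, HasDerivAt (v i) (v (i + 1) x) x) :
    ∀ i ≤ n, EqOn (iteratedDeriv i u) (v i) s := by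
  intro i
  induction i with
  | zero => simpa using hu
  | succ i ih =>
    intro hi x hx
    rw [iteratedDeriv_succ]
    have h : iteratedDeriv i u =ᶠ[nhds x] v i :=
      (ih (by omega)).eventuallyEq_of_mem (hs.mem_nhds hx)
    rw [h.deriv_eq, (hv i (by omega) x hx).deriv]

theorem abs_Kgreen_le_left {x y : ℝ} (hx : |x| ≤ 1) (hy : y ∈ Icc (0 : ℝ) 1) :
    |Kgreen x y| ≤ 4 * x ^ 2 := by
  obtain ⟨h1, h2⟩ := abs_le.1 hx
  obtain ⟨h3, h4⟩ := hy
  unfold Kgreen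
  split_ifs with h
  · have hA : 0 ≤ 2 * x * (1 - y) + x - y := by nlinarith
    have hB : 2 * x * (1 - y) + x - y ≤ 3 := by nlinarith
    have hC : (1 - x) ^ 2 ≤ 1 := by nlinarith
    have hD : y ^ 2 ≤ x ^ 2 := by nlinarith
    rw [abs_of_nonneg (by positivity)]
    calc _ ≤ (1 / 6) * 1 * x ^ 2 * 3 := by gcongr
      _ ≤ _ := by nlinarith [sq_nonneg x]
  · have hA : |2 * y * (1 - x) + y - x| ≤ 6 := abs_le.2 ⟨by nlinarith, by nlinarith⟩
    have hC : (1 - y) ^ 2 ≤ 1 := by nlinarith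
    rw [abs_mul, abs_of_nonneg (by positivity)]
    calc _ ≤ (1 / 6) * x ^ 2 * 1 * 6 := by gcongr
      _ ≤ _ := by nlinarith [sq_nonneg x]

theorem Kgreen_one_sub (x y : ℝ) : Kgreen (1 - x) (1 - y) = Kgreen x y := by
  unfold Kgreen
  rcases lt_trichotomy x y with h | rfl | h
  · rw [if_pos (by linarith), if_neg (by linarith)]; ring
  · simp only [le_refl, if_true]; ring
  · rw [if_neg (by linarith), if_pos h.le]; ring

theorem abs_Kgreen_le_right {x y : ℝ} (hx : |x - 1| ≤ 1) (hy : y ∈ Icc (0 : ℝ) 1) :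
    |Kgreen x y| ≤ 4 * (x - 1) ^ 2 := by
  have h := abs_Kgreen_le_left (x := 1 - x) (y := 1 - y) (by rwa [abs_sub_comm])
    ⟨by linarith [hy.2], by linarith [hy.1]⟩
  rw [Kgreen_one_sub] at h
  linarith [h, show (1 - x) ^ 2 = (x - 1) ^ 2 by ring]

/-- A function vanishing to second order at `a` vanishes there along with its derivative. -/
theorem eq_zero_and_deriv_eq_zero_of_abs_le_sq {u : ℝ → ℝ} {a C : ℝ}
    (h : ∀ x, |x - a| ≤ 1 → |u x| ≤ C * (x - a) ^ 2) : u a = 0 ∧ deriv u a = 0 := by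
  have h0 : u a = 0 := by simpa using h a (by simp)
  refine ⟨h0, ?_⟩
  have hO : u =O[nhds a] fun x => ‖x - a‖ ^ 2 := by
    refine Asymptotics.IsBigO.of_bound C ?_
    filter_upwards [Metric.closedBall_mem_nhds a one_pos] with x hx
    simpa [Real.dist_eq] using h x (by simpa [Real.dist_eq] using hx)
  have := (hO.hasFDerivAt (by norm_num)).hasDerivAt.deriv
  simpa using this

theorem exists_abs_integral_Kgreen_le {g : ℝ → ℝ} (hg : Continuous g) {a : ℝ}
    (h : ∀ x y : ℝ, |x - a| ≤ 1 → y ∈ Icc (0 : ℝ) 1 → |Kgreen x y| ≤ 4 * (x - a) ^ 2) :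
    ∃ C, ∀ x, |x - a| ≤ 1 → |∫ y in (0 : ℝ)..1, Kgreen x y * g y| ≤ C * (x - a) ^ 2 := by
  obtain ⟨M, hM⟩ := isCompact_Icc.exists_bound_of_continuousOn (s := Icc (0 : ℝ) 1)
    hg.continuousOn
  refine ⟨4 * M, fun x hx => ?_⟩
  have := intervalIntegral.norm_integral_le_of_norm_le_const (a := (0 : ℝ)) (b := 1)
    (f := fun y => Kgreen x y * g y) (C := 4 * (x - a) ^ 2 * M) fun y hy => by
      rw [uIoc_of_le zero_le_one] at hy
      have hy' : y ∈ Icc (0 : ℝ) 1 := ⟨hy.1.le, hy.2⟩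
      rw [norm_mul]
      exact mul_le_mul (h x y hx hy') (hM y hy') (norm_nonneg _) (by positivity)
  simp only [Real.norm_eq_abs, sub_zero, abs_one, mul_one] at this
  linarith

/-- The `k`-th moment of `g` on `[0, x]`. -/
noncomputable def moment (g : ℝ → ℝ) (k : ℕ) (x : ℝ) : ℝ := ∫ y in (0 : ℝ)..x, y ^ k * g y

theorem hasDerivAt_moment {g : ℝ → ℝ} (hg : Continuous g) (k : ℕ) (x : ℝ) :
    HasDerivAt (moment g k) (x ^ k * g x) x :=
  (show Continuous fun y => y ^ k * g y by fun_prop).integral_hasStrictDerivAt 0 x |>.hasDerivAt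

theorem integral_Kgreen_mul {g : ℝ → ℝ} (hg : Continuous g) {x : ℝ} (hx : x ∈ Icc (0 : ℝ) 1) :
    ∫ y in (0 : ℝ)..1, Kgreen x y * g y =
      (∫ y in (0 : ℝ)..1, (1 - y) ^ 2 * y / 2 * g y) * x ^ 2 -
      (∫ y in (0 : ℝ)..1, (1 - y) ^ 2 * (1 + 2 * y) / 6 * g y) * x ^ 3 +
      (x ^ 3 * moment g 0 x - 3 * x ^ 2 * moment g 1 x + 3 * x * moment g 2 x
        - moment g 3 x) / 6 := by
  set p : ℝ → ℝ := fun y =>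
    (1 - y) ^ 2 * y / 2 * g y * x ^ 2 - (1 - y) ^ 2 * (1 + 2 * y) / 6 * g y * x ^ 3 with hp
  set q : ℝ → ℝ := fun y => (x ^ 3 * (y ^ 0 * g y) - 3 * x ^ 2 * (y ^ 1 * g y)
    + 3 * x * (y ^ 2 * g y) - y ^ 3 * g y) / 6 with hq
  have hpc : Continuous p := by fun_prop
  have hqc : Continuous q := by fun_prop
  have e1 : EqOn (fun y => Kgreen x y * g y) (fun y => p y + q y) (uIcc 0 x) := by
    intro y hy
    rw [uIcc_of_le hx.1] at hy
    simp only [Kgreen, if_pos hy.2, hp, hq]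
    ring
  have e2 : EqOn (fun y => Kgreen x y * g y) p (uIcc x 1) := by
    intro y hy
    rw [uIcc_of_le hx.2] at hy
    rcases hy.1.eq_or_lt with rfl | h
    · simp only [Kgreen, le_refl, if_true, hp]; ring
    · simp only [Kgreen, if_neg h.not_ge, hp]; ring
  have i1 : IntervalIntegrable (fun y => Kgreen x y * g y) MeasureTheory.volume 0 x :=
    ((hpc.add hqc).continuousOn.congr e1).intervalIntegrable
  have i2 : IntervalIntegrable (fun y => Kgreen x y * g y) MeasureTheory.volume x 1 :=
    (hpc.continuousOn.congr e2).intervalIntegrable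
  have hP : ∫ y in (0 : ℝ)..1, p y =
      (∫ y in (0 : ℝ)..1, (1 - y) ^ 2 * y / 2 * g y) * x ^ 2 -
      (∫ y in (0 : ℝ)..1, (1 - y) ^ 2 * (1 + 2 * y) / 6 * g y) * x ^ 3 := by
    rw [hp, intervalIntegral.integral_sub, intervalIntegral.integral_mul_const,
      intervalIntegral.integral_mul_const]
    all_goals exact Continuous.intervalIntegrable (by fun_prop) _ _
  have hQ : ∫ y in (0 : ℝ)..x, q y =
      (x ^ 3 * moment g 0 x - 3 * x ^ 2 * moment g 1 x + 3 * x * moment g 2 x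
        - moment g 3 x) / 6 := by
    rw [hq, intervalIntegral.integral_div, intervalIntegral.integral_sub,
      intervalIntegral.integral_add, intervalIntegral.integral_sub,
      intervalIntegral.integral_const_mul, intervalIntegral.integral_const_mul,
      intervalIntegral.integral_const_mul]
    · rfl
    all_goals exact Continuous.intervalIntegrable (by fun_prop) _ _
  rw [← intervalIntegral.integral_add_adjacent_intervals i1 i2,
    intervalIntegral.integral_congr e1, intervalIntegral.integral_congr e2,
    intervalIntegral.integral_add (hpc.intervalIntegrable _ _) (hqc.intervalIntegrable _ _),
    ← hP, ← hQ, ← intervalIntegral.integral_add_adjacent_intervals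
      (hpc.intervalIntegrable 0 x) (hpc.intervalIntegrable x 1)]
  ring

/-- The function `a x² - b x³ + ∫₀ˣ (x-y)³ g(y) / 6 dy`, expanded in moments of `g`, followed by
its first four derivatives. -/
noncomputable def greenDerivs (g : ℝ → ℝ) (a b : ℝ) : ℕ → ℝ → ℝ
  | 0, x => a * x ^ 2 - b * x ^ 3 + (x ^ 3 * moment g 0 x - 3 * x ^ 2 * moment g 1 x
      + 3 * x * moment g 2 x - moment g 3 x) / 6
  | 1, x => a * (2 * x) - b * (3 * x ^ 2) + (x ^ 2 * moment g 0 x - 2 * x * moment g 1 x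
      + moment g 2 x) / 2
  | 2, x => a * 2 - b * (6 * x) + (x * moment g 0 x - moment g 1 x)
  | 3, x => -(b * 6) + moment g 0 x
  | _, x => g x

theorem hasDerivAt_greenDerivs {g : ℝ → ℝ} (hg : Continuous g) (a b : ℝ) {i : ℕ} (hi : i < 4)
    (x : ℝ) : HasDerivAt (greenDerivs g a b i) (greenDerivs g a b (i + 1) x) x := by
  have m := fun k => hasDerivAt_moment hg k x
  have d := hasDerivAt_id x
  have d2 := hasDerivAt_pow 2 x
  have d3 := hasDerivAt_pow 3 x
  interval_cases i
  · refine HasDerivAt.congr_deriv (((d2.const_mul a).sub (d3.const_mul b)).add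
      (((((d3.mul (m 0)).sub ((d2.const_mul 3).mul (m 1))).add
        ((d.const_mul 3).mul (m 2))).sub (m 3)).div_const 6)) ?_
    simp [greenDerivs]
    ring
  · refine HasDerivAt.congr_deriv ((((d.const_mul 2).const_mul a).sub
      ((d2.const_mul 3).const_mul b)).add
      ((((d2.mul (m 0)).sub ((d.const_mul 2).mul (m 1))).add (m 2)).div_const 2)) ?_
    simp [greenDerivs]
    ring
  · refine HasDerivAt.congr_deriv (((hasDerivAt_const x (a * 2)).sub
      ((d.const_mul 6).const_mul b)).add ((d.mul (m 0)).sub (m 1))) ?_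
    simp [greenDerivs]
  · refine HasDerivAt.congr_deriv ((hasDerivAt_const x (-(b * 6))).add (m 0)) ?_
    simp [greenDerivs]

/-- Green's function of the clamped biharmonic problem: for every continuous
`f : [0,1] → ℝ`, the function `u(x) = ∫₀¹ K(x,y) f(y) dy` satisfies the clamped boundary
conditions, is four times differentiable on `(0,1)`, and `u⁗ = f` on `(0,1)`. -/
theorem green_function_biharmonic
    (f : ℝ → ℝ) (hf : ContinuousOn f (Set.Icc 0 1)) (u : ℝ → ℝ)
    (hu : ∀ x : ℝ, u x = ∫ y in (0:ℝ)..1, Kgreen x y * f y) :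
    u 0 = 0 ∧ deriv u 0 = 0 ∧ u 1 = 0 ∧ deriv u 1 = 0 ∧
    (∀ i : ℕ, i < 4 → ∀ x ∈ Set.Ioo (0:ℝ) 1, DifferentiableAt ℝ (iteratedDeriv i u) x) ∧
    ∀ x ∈ Set.Ioo (0:ℝ) 1, iteratedDeriv 4 u x = f x := by
  obtain ⟨g, hg, hfg⟩ : ∃ g : ℝ → ℝ, Continuous g ∧ EqOn f g (Icc 0 1) :=
    ⟨IccExtend zero_le_one ((Icc (0 : ℝ) 1).domRestrict f), hf.domRestrict.Icc_extend',
      fun x hx => (IccExtend_of_mem zero_le_one ((Icc (0 : ℝ) 1).domRestrict f) hx).symm⟩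
  replace hu : ∀ x, u x = ∫ y in (0 : ℝ)..1, Kgreen x y * g y := fun x => by
    rw [hu]
    refine intervalIntegral.integral_congr fun y hy => ?_
    rw [uIcc_of_le zero_le_one] at hy
    simp only [hfg hy]
  obtain ⟨C₀, hC₀⟩ := exists_abs_integral_Kgreen_le hg (a := 0) fun x y hx hy => by
    simpa using abs_Kgreen_le_left (by simpa using hx) hy
  obtain ⟨C₁, hC₁⟩ := exists_abs_integral_Kgreen_le hg (a := 1) fun x y hx hy =>
    abs_Kgreen_le_right hx hy
  simp only [← hu] at hC₀ hC₁
  obtain ⟨h0, h0'⟩ := eq_zero_and_deriv_eq_zero_of_abs_le_sq hC₀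
  obtain ⟨h1, h1'⟩ := eq_zero_and_deriv_eq_zero_of_abs_le_sq hC₁
  set a := ∫ y in (0 : ℝ)..1, (1 - y) ^ 2 * y / 2 * g y
  set b := ∫ y in (0 : ℝ)..1, (1 - y) ^ 2 * (1 + 2 * y) / 6 * g y
  have hv := eqOn_iteratedDeriv_of_hasDerivAt (v := greenDerivs g a b) (n := 4) isOpen_Ioo
    (fun x hx => (hu x).trans (integral_Kgreen_mul hg (Ioo_subset_Icc_self hx)))
    (fun i hi x _ => hasDerivAt_greenDerivs hg a b hi x)
  refine ⟨h0, h0', h1, h1', fun i hi x hx => ?_, fun x hx => ?_⟩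
  · exact (hasDerivAt_greenDerivs hg a b hi x).differentiableAt.congr_of_eventuallyEq
      ((hv i hi.le).eventuallyEq_of_mem (isOpen_Ioo.mem_nhds hx))
  · rw [hv 4 le_rfl hx, hfg (Ioo_subset_Icc_self hx)]
    rfl
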